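/- (Proposition 2.) Fix S > 0 and write h = h(S) > 0. If η_β/c < (1/(ε−1))·h/((δr·h + 1)·log(δr·h + 1)) (equivalently ψ(0,S) > 0), then there exists β* > 0 such that ∂V/∂β (β*, S) = 0 and V(β*, S) ≥ V(β, S) for all β ∈ [0, β*]; i.e., there exists at least one positive stationary point of β ↦ V(β,S) at which V attains a (possibly local) maximum. -/

import Mathlib

/-- Cache hit probability `h(S) = log(S+1)/log Σ`. -/
noncomputable def hitProb (Sig S : ℝ) : ℝ := Real.log (S + 1) / Real.log Sig

/-- Average network capacity `R(β,S) = (δr + β)·h(S) + 1`. -/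
noncomputable def capR (Sig dr β S : ℝ) : ℝ := (dr + β) * hitProb Sig S + 1

/-- Coefficient `a(β) = ((ε−1)^(ε−1)/ε^ε)·A/(c + η_β·β)^(ε−1)`. -/
noncomputable def coefA (A ε c ηβ β : ℝ) : ℝ :=
  (ε - 1) ^ (ε - 1) / ε ^ ε * A / (c + ηβ * β) ^ (ε - 1)

/-- Operational profit `V(β,S) = a(β)·log R(β,S) − (c_S + η_S)·S − f`. -/
noncomputable def profitV (Sig dr A ε c ηβ cS ηS f β S : ℝ) : ℝ :=
  coefA A ε c ηβ β * Real.log (capR Sig dr β S) - (cS + ηS) * S - f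

/-- If `g` has a positive derivative at `0`, drops below `g 0` somewhere to the right, and is
differentiable on `[0, ∞)`, then it has a positive critical point that maximizes `g` to its left. -/
theorem exists_pos_critical_point_max {g g' : ℝ → ℝ}
    (hg : ∀ x, 0 ≤ x → HasDerivAt g (g' x) x) (h0 : 0 < g' 0)
    {M : ℝ} (hM : 0 < M) (hgM : g M < g 0) :
    ∃ x, 0 < x ∧ HasDerivAt g 0 x ∧ ∀ y ∈ Set.Icc 0 x, g y ≤ g x := by
  obtain ⟨x, hx, hmax⟩ := isCompact_Icc.exists_isMaxOn (Set.nonempty_Icc.2 hM.le)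
    (fun y hy => (hg y hy.1).continuousAt.continuousWithinAt : ContinuousOn g (Set.Icc 0 M))
  rw [isMaxOn_iff] at hmax
  have hxM : x < M := by
    refine lt_of_le_of_ne hx.2 ?_
    rintro rfl
    exact absurd (hmax 0 ⟨le_rfl, hM.le⟩) (not_le.2 hgM)
  have hx0 : 0 < x := by
    refine lt_of_le_of_ne hx.1 ?_
    rintro rfl
    have hslope := (hasDerivAt_iff_tendsto_slope.1 (hg 0 le_rfl)).mono_left
      (nhdsWithin_mono 0 (fun y (hy : 0 < y) => hy.ne') : nhdsWithin (0 : ℝ) (Set.Ioi 0) ≤ _)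
    obtain ⟨y, hy, hyM⟩ := ((hslope.eventually (lt_mem_nhds h0)).and
      (Ioo_mem_nhdsGT hM)).exists
    have hle := hmax y ⟨hyM.1.le, hyM.2.le⟩
    rw [slope_def_field, sub_zero] at hy
    exact absurd hy (not_lt.2 (div_nonpos_of_nonpos_of_nonneg (by linarith) hyM.1.le))
  have hloc : IsLocalMax g x := by
    filter_upwards [Icc_mem_nhds hx0 hxM] with y hy using hmax y hy
  have hd := hg x hx0.le
  rw [hloc.hasDerivAt_eq_zero hd] at hd
  exact ⟨x, hx0, hd, fun y hy => hmax y ⟨hy.1, hy.2.trans hx.2⟩⟩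

theorem hitProb_pos {Sig S : ℝ} (hSig : 1 < Sig) (hS : 0 < S) : 0 < hitProb Sig S :=
  div_pos (Real.log_pos (by linarith)) (Real.log_pos hSig)

theorem one_lt_capR {Sig dr β S : ℝ} (hSig : 1 < Sig) (hdr : 0 < dr) (hS : 0 < S)
    (hβ : 0 ≤ β) : 1 < capR Sig dr β S := by
  have := mul_pos (add_pos_of_pos_of_nonneg hdr hβ) (hitProb_pos hSig hS)
  unfold capR
  linarith

theorem coefA_pos {A ε c ηβ β : ℝ} (hA : 0 < A) (hε : 1 < ε) (hu : 0 < c + ηβ * β) :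
    0 < coefA A ε c ηβ β := by
  have h1 : 0 < ε - 1 := by linarith
  have h2 : 0 < ε := by linarith
  unfold coefA
  positivity

theorem hasDerivAt_coefA {A ε c ηβ β : ℝ} (hu : 0 < c + ηβ * β) :
    HasDerivAt (coefA A ε c ηβ)
      (-(coefA A ε c ηβ β * ((ε - 1) * ηβ / (c + ηβ * β)))) β := by
  have hlin : HasDerivAt (fun b => c + ηβ * b) ηβ β := by
    simpa using ((hasDerivAt_id β).const_mul ηβ).const_add c
  have hpow := hlin.rpow_const (p := ε - 1) (Or.inl hu.ne')
  have hpos : 0 < (c + ηβ * β) ^ (ε - 1) := Real.rpow_pos_of_pos hu _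
  refine ((hasDerivAt_const β ((ε - 1) ^ (ε - 1) / ε ^ ε * A)).div hpow hpos.ne').congr_deriv ?_
  rw [Real.rpow_sub_one hu.ne' (ε - 1), coefA]
  generalize (ε - 1) ^ (ε - 1) / ε ^ ε * A = K
  generalize (c + ηβ * β) ^ (ε - 1) = P at hpos ⊢
  generalize c + ηβ * β = u at hu ⊢
  field_simp
  ring

theorem hasDerivAt_profitV {Sig dr A ε c ηβ cS ηS f β S : ℝ}
    (hu : 0 < c + ηβ * β) (hR : 0 < capR Sig dr β S) :
    HasDerivAt (fun b => profitV Sig dr A ε c ηβ cS ηS f b S)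
      (coefA A ε c ηβ β * (hitProb Sig S / capR Sig dr β S -
        (ε - 1) * ηβ / (c + ηβ * β) * Real.log (capR Sig dr β S))) β := by
  have hlin : HasDerivAt (fun b => capR Sig dr b S) (hitProb Sig S) β := by
    simpa [capR] using
      (((hasDerivAt_id β).const_add dr).mul_const (hitProb Sig S)).add_const (1 : ℝ)
  refine ((((hasDerivAt_coefA (A := A) (ε := ε) hu).mul (hlin.log hR.ne')).sub_const
    ((cS + ηS) * S)).sub_const f).congr_deriv ?_
  ring

open Filter Topology in
/-- Revenue vanishes as the network capacity grows. -/
theorem tendsto_coefA_mul_log_capR {Sig dr A ε c ηβ S : ℝ} (hSig : 1 < Sig) (hdr : 0 < dr)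
    (hA : 0 < A) (hε : 1 < ε) (hc : 0 < c) (hηβ : 0 < ηβ) (hS : 0 < S) :
    Tendsto (fun b => coefA A ε c ηβ b * Real.log (capR Sig dr b S)) atTop (𝓝 0) := by
  have hh := hitProb_pos hSig hS
  set h := hitProb Sig S with h_def
  set K := (ε - 1) ^ (ε - 1) / ε ^ ε * A with K_def
  set C := h / ηβ + (dr * h + 1) / c with C_def
  have hp : 0 < ε - 1 := by linarith
  have hC : 0 < C := by positivity
  have hlin : Tendsto (fun b => c + ηβ * b) atTop atTop :=
    tendsto_atTop_add_const_left _ _ (tendsto_id.const_mul_atTop hηβ)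
  have hbound : Tendsto (fun u : ℝ => K * (Real.log C * (u ^ (ε - 1))⁻¹ +
      Real.log u / u ^ (ε - 1))) atTop (𝓝 0) := by
    have h1 := (tendsto_rpow_atTop hp).inv_tendsto_atTop.const_mul (Real.log C)
    have h2 := (isLittleO_log_rpow_atTop hp).tendsto_div_nhds_zero
    simpa using (h1.add h2).const_mul K
  refine tendsto_of_tendsto_of_tendsto_of_le_of_le' tendsto_const_nhds (hbound.comp hlin) ?_ ?_
  · filter_upwards [eventually_ge_atTop 0] with b hb
    exact mul_nonneg (coefA_pos hA hε (by positivity)).le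
      (Real.log_nonneg (one_lt_capR hSig hdr hS hb).le)
  · filter_upwards [eventually_ge_atTop 0] with b hb
    have hu : 0 < c + ηβ * b := by positivity
    have hR := one_lt_capR hSig hdr hS hb
    have hRC : capR Sig dr b S ≤ C * (c + ηβ * b) := by
      have heq : C * (c + ηβ * b) =
          capR Sig dr b S + (h / ηβ * c + (dr * h + 1) / c * (ηβ * b)) := by
        rw [capR, ← h_def, C_def]
        field_simp
        ring
      have : 0 ≤ h / ηβ * c + (dr * h + 1) / c * (ηβ * b) := by positivity
      linarith
    have hlog := Real.log_le_log (by linarith) hRC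
    rw [Real.log_mul hC.ne' hu.ne'] at hlog
    refine (mul_le_mul_of_nonneg_left hlog (coefA_pos hA hε hu).le).trans_eq ?_
    simp only [coefA, Function.comp_apply, ← K_def]
    ring

/-- Proposition 2: Fix `S > 0` and write `h = h(S) > 0`.  If
`η_β/c < (1/(ε−1))·h/((δr·h + 1)·log(δr·h + 1))` (equivalently `ψ(0,S) > 0`),
then there exists `β* > 0` with `∂V/∂β(β*,S) = 0` and `V(β*,S) ≥ V(β,S)` for all
`β ∈ [0, β*]`; i.e., there is at least one positive stationary point of
`β ↦ V(β,S)` at which `V` attains a (possibly local) maximum. -/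
theorem capacity_stationary_max (Sig dr A ε c ηβ cS ηS f : ℝ)
    (hSig : 1 < Sig) (hdr : 0 < dr) (hA : 0 < A) (hε : 1 < ε) (hc : 0 < c)
    (hηβ : 0 < ηβ) (hcS : 0 ≤ cS) (hηS : 0 ≤ ηS) (hcη : 0 < cS + ηS)
    (S : ℝ) (hS : 0 < S)
    (hcond : ηβ / c < (1 / (ε - 1)) * hitProb Sig S /
      ((dr * hitProb Sig S + 1) * Real.log (dr * hitProb Sig S + 1))) :
    ∃ βstar, 0 < βstar ∧
      HasDerivAt (fun b => profitV Sig dr A ε c ηβ cS ηS f b S) 0 βstar ∧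
      ∀ β ∈ Set.Icc 0 βstar,
        profitV Sig dr A ε c ηβ cS ηS f β S ≤
          profitV Sig dr A ε c ηβ cS ηS f βstar S := by
  have hε' : 0 < ε - 1 := by linarith
  have hR0 := one_lt_capR hSig hdr hS le_rfl
  have hlog0 := Real.log_pos hR0
  have hu : ∀ x : ℝ, 0 ≤ x → 0 < c + ηβ * x := fun x hx => by positivity
  have ha0 := coefA_pos hA hε (hu 0 le_rfl)
  obtain ⟨M, hMlt, hM⟩ := (((tendsto_coefA_mul_log_capR hSig hdr hA hε hc hηβ hS).eventually
    (gt_mem_nhds (mul_pos ha0 hlog0))).and (Filter.eventually_gt_atTop 0)).exists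
  refine exists_pos_critical_point_max
    (fun x hx => hasDerivAt_profitV (hu x hx) (zero_lt_one.trans (one_lt_capR hSig hdr hS hx)))
    (mul_pos ha0 ?_) hM ?_
  · have hR0' : capR Sig dr 0 S = dr * hitProb Sig S + 1 := by simp [capR]
    rw [← hR0', div_mul_eq_mul_div, one_mul, div_div, div_lt_div_iff₀ hc (by positivity)] at hcond
    rw [mul_zero, add_zero, sub_pos, div_mul_eq_mul_div, div_lt_div_iff₀ hc (by positivity)]
    linarith
  · simp only [profitV]
    linarith
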